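/- Let (c, s) solve the initial value problem IVP on the open disc B_r(0) with r = 2^(-2/3). If z in B_r(0) is nonzero and s(z)^3 is a real number, then s(z) is a positive real multiple of z; that is, there exists a real number t > 0 with s(z) = t·z. -/

import Mathlib

open Complex Metric Set

/-- A function with zero derivative on a ball about `0` equals its value at `0` there. -/
lemma eq_apply_zero_of_hasDerivAt_zero {f : ℂ → ℂ} {r : ℝ}
    (hf : ∀ z ∈ ball (0 : ℂ) r, HasDerivAt f 0 z) {z : ℂ} (hz : z ∈ ball (0 : ℂ) r) :
    f z = f 0 :=
  isOpen_ball.is_const_of_deriv_eq_zero (convex_ball _ _).isPreconnected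
    (fun w hw => (hf w hw).differentiableAt.differentiableWithinAt)
    (fun w hw => (hf w hw).deriv) hz (mem_ball_self (pos_of_mem_ball hz))

/-- The derivative of `τ ↦ f (τ z)` along a ray. -/
lemma hasDerivAt_comp_ofReal_mul {f : ℂ → ℂ} {f' z : ℂ} {τ : ℝ}
    (hf : HasDerivAt f f' (τ * z)) : HasDerivAt (fun x : ℝ => f (x * z)) (f' * z) τ := by
  have h : HasDerivAt (fun x : ℂ => x * z) z (τ : ℂ) := by
    simpa using (hasDerivAt_id (τ : ℂ)).mul_const z
  exact (HasDerivAt.comp (τ : ℂ) hf h).comp_ofReal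

lemma ofReal_mul_mem_ball {z : ℂ} {r τ : ℝ} (hz : z ∈ ball (0 : ℂ) r) (hτ : τ ∈ Icc (0 : ℝ) 1) :
    (τ : ℂ) * z ∈ ball (0 : ℂ) r := by
  rw [mem_ball_zero_iff] at hz ⊢
  rw [norm_mul, Complex.norm_real, Real.norm_of_nonneg hτ.1]
  exact (mul_le_of_le_one_left (norm_nonneg z) hτ.2).trans_lt hz

/-- The first integral `c ^ 3 + s ^ 3 = 1` of the system `c' = -s ^ 2`, `s' = c ^ 2`. -/
lemma cube_add_cube_eq_one {r : ℝ} {c s : ℂ → ℂ} (hc0 : c 0 = 1) (hs0 : s 0 = 0)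
    (hderiv : ∀ z ∈ ball (0 : ℂ) r,
      HasDerivAt c (-(s z) ^ 2) z ∧ HasDerivAt s ((c z) ^ 2) z)
    {z : ℂ} (hz : z ∈ ball (0 : ℂ) r) : c z ^ 3 + s z ^ 3 = 1 := by
  have h := eq_apply_zero_of_hasDerivAt_zero (f := fun z => c z ^ 3 + s z ^ 3) (fun w hw => by
    refine (((hderiv w hw).1.fun_pow 3).fun_add ((hderiv w hw).2.fun_pow 3)).congr_deriv ?_
    push_cast
    ring) hz
  simpa [hc0, hs0] using h

/-- If `q ^ 3 = 2`, a solution on the ball of radius `(q ^ 2)⁻¹` satisfies `‖s z‖ < 1`. -/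
lemma norm_lt_one_of_solution {r q : ℝ} (hq : 0 < q) (hq3 : q ^ 3 = 2) (hr : q ^ 2 * r = 1)
    {c s : ℂ → ℂ} (hc0 : c 0 = 1) (hs0 : s 0 = 0)
    (hderiv : ∀ z ∈ ball (0 : ℂ) r,
      HasDerivAt c (-(s z) ^ 2) z ∧ HasDerivAt s ((c z) ^ 2) z)
    {z : ℂ} (hz : z ∈ ball (0 : ℂ) r) : ‖s z‖ < 1 := by
  rcases eq_or_ne z 0 with rfl | hz0
  · simp [hs0]
  have hzpos : 0 < ‖z‖ := norm_pos_iff.2 hz0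
  have hKz : q ^ 2 * ‖z‖ < 1 := by
    rw [← hr]
    exact mul_lt_mul_of_pos_left (mem_ball_zero_iff.1 hz) (by positivity)
  have hd : ∀ x ∈ Icc (0 : ℝ) 1,
      HasDerivAt (fun x : ℝ => s (x * z)) (c (x * z) ^ 2 * z) x := fun x hx =>
    hasDerivAt_comp_ofReal_mul (hderiv _ (ofReal_mul_mem_ball hz hx)).2
  have hbound := image_norm_le_of_norm_deriv_right_lt_deriv_boundary
    (f := fun x : ℝ => s (x * z)) (a := 0) (b := 1) (f' := fun x => c (x * z) ^ 2 * z)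
    (B := fun x => x * (q ^ 2 * ‖z‖)) (B' := fun _ => q ^ 2 * ‖z‖)
    (fun x hx => (hd x hx).continuousAt.continuousWithinAt)
    (fun x hx => (hd x (Ico_subset_Icc_self hx)).hasDerivWithinAt)
    (by simp [hs0])
    (fun x => by simpa using (hasDerivAt_id x).mul_const (q ^ 2 * ‖z‖))
    (fun x hx heq => by
      have hs : ‖s (x * z)‖ < 1 := by
        have := mul_le_of_le_one_left (by positivity : 0 ≤ q ^ 2 * ‖z‖) hx.2.le
        linarith
      have hfi := cube_add_cube_eq_one hc0 hs0 hderiv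
        (ofReal_mul_mem_ball hz (Ico_subset_Icc_self hx))
      have hc : ‖c (x * z)‖ ^ 3 < q ^ 3 := by
        rw [← norm_pow, eq_sub_of_add_eq hfi, hq3]
        refine (norm_sub_le _ _).trans_lt ?_
        rw [norm_one, norm_pow]
        have := pow_lt_one₀ (norm_nonneg _) hs three_ne_zero
        linarith
      have hcq : ‖c (x * z)‖ < q := lt_of_pow_lt_pow_left₀ 3 hq.le hc
      rw [norm_mul, norm_pow]
      gcongr)
  have h1 : ‖s (((1 : ℝ) : ℂ) * z)‖ ≤ 1 * (q ^ 2 * ‖z‖) := hbound ⟨zero_le_one, le_rfl⟩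
  rw [ofReal_one, one_mul, one_mul] at h1
  exact h1.trans_lt hKz

/-- The principal branch of `(1 - w ^ 3) ^ (-2/3)`. -/
noncomputable def dixonIntegrand (w : ℂ) : ℂ := exp (-(2 / 3) * log (1 - w ^ 3))

lemma one_sub_cube_mem_slitPlane {w : ℂ} (hw : ‖w‖ < 1) : 1 - w ^ 3 ∈ slitPlane := by
  rw [sub_eq_add_neg]
  refine mem_slitPlane_of_norm_lt_one ?_
  rw [norm_neg, norm_pow]
  exact pow_lt_one₀ (norm_nonneg _) hw three_ne_zero

lemma hasDerivAt_dixonIntegrand {w : ℂ} (hw : ‖w‖ < 1) :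
    HasDerivAt dixonIntegrand (2 * w ^ 2 / (1 - w ^ 3) * dixonIntegrand w) w := by
  have h := ((((hasDerivAt_pow 3 w).const_sub 1).clog
    (one_sub_cube_mem_slitPlane hw)).const_mul (-(2 / 3) : ℂ)).cexp
  refine h.congr_deriv ?_
  simp only [dixonIntegrand]
  push_cast
  ring

/-- The function `(1 - w ^ 3) ^ (-2/3)` is positive where `w ^ 3` is real. -/
lemma dixonIntegrand_pos {w : ℂ} (hw : ‖w‖ < 1) (him : (w ^ 3).im = 0) :
    0 < (dixonIntegrand w).re ∧ (dixonIntegrand w).im = 0 := by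
  have hx : w ^ 3 = ((w ^ 3).re : ℂ) := Complex.ext (by simp) (by simpa using him)
  have hlt : 0 ≤ 1 - (w ^ 3).re := by
    have h1 := re_le_norm (w ^ 3)
    rw [norm_pow] at h1
    have := pow_lt_one₀ (norm_nonneg _) hw three_ne_zero
    linarith
  have : dixonIntegrand w = ((Real.exp (-(2 / 3) * Real.log (1 - (w ^ 3).re)) : ℝ) : ℂ) := by
    rw [dixonIntegrand, hx, ofReal_re]
    push_cast [ofReal_log hlt]
    rfl
  rw [this]
  exact ⟨by rw [ofReal_re]; exact Real.exp_pos _, ofReal_im _⟩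

/-- A primitive of `(1 - w ^ 3) ^ (-2/3)` on the unit disc vanishing at `0` is a positive multiple
of `w` where `w ^ 3` is real. -/
lemma exists_pos_primitive_eq_mul {P : ℂ → ℂ} (hP0 : P 0 = 0)
    (hP : ∀ w ∈ ball (0 : ℂ) 1, HasDerivAt P (dixonIntegrand w) w)
    {w : ℂ} (hw : ‖w‖ < 1) (hw0 : w ≠ 0) (him : (w ^ 3).im = 0) :
    ∃ t : ℝ, 0 < t ∧ P w = t * w := by
  have hmem : ∀ x ∈ Icc (0 : ℝ) 1, (x : ℂ) * w ∈ ball (0 : ℂ) 1 := fun x hx =>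
    ofReal_mul_mem_ball (mem_ball_zero_iff.2 hw) hx
  have hpos : ∀ x ∈ Icc (0 : ℝ) 1,
      0 < (dixonIntegrand (x * w)).re ∧ (dixonIntegrand (x * w)).im = 0 := fun x hx =>
    dixonIntegrand_pos (mem_ball_zero_iff.1 (hmem x hx)) (by
      rw [mul_pow, ← ofReal_pow, im_ofReal_mul, him, mul_zero])
  have hd : ∀ x ∈ Icc (0 : ℝ) 1,
      HasDerivAt (fun x : ℝ => P (x * w) / w) (dixonIntegrand (x * w)) x := fun x hx => by
    simpa [hw0] using (hasDerivAt_comp_ofReal_mul (hP _ (hmem x hx))).div_const w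
  have hre : ∀ x ∈ Icc (0 : ℝ) 1,
      HasDerivAt (fun x : ℝ => (P (x * w) / w).re) (dixonIntegrand (x * w)).re x := fun x hx =>
    reCLM.hasFDerivAt.comp_hasDerivAt x (hd x hx)
  have himd : ∀ x ∈ Icc (0 : ℝ) 1,
      HasDerivAt (fun x : ℝ => (P (x * w) / w).im) (dixonIntegrand (x * w)).im x := fun x hx =>
    imCLM.hasFDerivAt.comp_hasDerivAt x (hd x hx)
  obtain ⟨x, hx, hxe⟩ := exists_hasDerivAt_eq_slope _ _ zero_lt_one
    (fun x hx => (hre x hx).continuousAt.continuousWithinAt)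
    (fun x hx => hre x (Ioo_subset_Icc_self hx))
  obtain ⟨y, hy, hye⟩ := exists_hasDerivAt_eq_slope _ _ zero_lt_one
    (fun x hx => (himd x hx).continuousAt.continuousWithinAt)
    (fun x hx => himd x (Ioo_subset_Icc_self hx))
  have hx1 := (hpos x (Ioo_subset_Icc_self hx)).1
  rw [hxe] at hx1
  rw [(hpos y (Ioo_subset_Icc_self hy)).2] at hye
  simp only [ofReal_one, ofReal_zero, one_mul, zero_mul, hP0, zero_div, zero_re, zero_im, sub_zero,
    div_one] at hx1 hye
  refine ⟨(P w / w).re, hx1, ?_⟩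
  rw [show ((P w / w).re : ℂ) = P w / w from Complex.ext (by simp) (by simpa using hye),
    div_mul_cancel₀ _ hw0]

/-- If `(c, s)` solves the IVP on `B_r(0)`, `r = 2^(-2/3)`, `z` in
the disc is nonzero, and `s z ^ 3` is real, then `s z` is a positive real multiple
of `z`. -/
theorem dixon_reality (r : ℝ) (hr : r = (2:ℝ) ^ (-(2/3) : ℝ)) (c s : ℂ → ℂ)
    (hc0 : c 0 = 1) (hs0 : s 0 = 0)
    (hderiv : ∀ z ∈ Metric.ball (0:ℂ) r,
      HasDerivAt c (-(s z) ^ 2) z ∧ HasDerivAt s ((c z) ^ 2) z) :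
    ∀ z ∈ Metric.ball (0:ℂ) r, z ≠ 0 → (s z ^ 3).im = 0 →
      ∃ t : ℝ, 0 < t ∧ s z = (t : ℂ) * z := by
  intro z hz hz0 him
  have hs1 : ∀ w ∈ ball (0 : ℂ) r, ‖s w‖ < 1 := fun w hw => by
    refine norm_lt_one_of_solution (q := (2 : ℝ) ^ (1 / 3 : ℝ)) (by positivity) ?_ ?_
      hc0 hs0 hderiv hw
    · rw [← Real.rpow_natCast, ← Real.rpow_mul zero_le_two]
      norm_num
    · rw [hr, ← Real.rpow_natCast, ← Real.rpow_mul zero_le_two, ← Real.rpow_add two_pos]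
      norm_num
  have hfactor : ∀ w ∈ ball (0 : ℂ) r, c w ^ 2 * dixonIntegrand (s w) = 1 := fun w hw => by
    have h := eq_apply_zero_of_hasDerivAt_zero (f := fun w => c w ^ 2 * dixonIntegrand (s w))
      (fun w hw => by
        have hne := slitPlane_ne_zero (one_sub_cube_mem_slitPlane (hs1 w hw))
        have hfi := cube_add_cube_eq_one hc0 hs0 hderiv hw
        refine (((hderiv w hw).1.fun_pow 2).fun_mul
          ((hasDerivAt_dixonIntegrand (hs1 w hw)).comp w (hderiv w hw).2)).congr_deriv ?_
        rw [← eq_sub_of_add_eq hfi] at hne ⊢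
        have hc : c w ≠ 0 := fun h => hne (by simp [h])
        simp only [Function.comp_apply]
        field_simp
        push_cast
        ring) hw
    simpa [hc0, hs0, dixonIntegrand] using h
  have hdiff : DifferentiableOn ℂ dixonIntegrand (ball 0 1) := fun w hw =>
    (hasDerivAt_dixonIntegrand (mem_ball_zero_iff.1 hw)).differentiableAt.differentiableWithinAt
  obtain ⟨P, hP0, hP⟩ := hdiff.isExactOn_ball.with_val_at 0 0
  have hinv : P (s z) = z := by
    have h := eq_apply_zero_of_hasDerivAt_zero (f := fun w => P (s w) - w) (fun w hw => by
      refine (((hP _ (mem_ball_zero_iff.2 (hs1 w hw))).comp w (hderiv w hw).2).fun_sub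
        (hasDerivAt_id w)).congr_deriv ?_
      rw [mul_comm, hfactor w hw, sub_self]) hz
    simpa [hs0, hP0, sub_eq_zero] using h
  have hsz : s z ≠ 0 := fun h => hz0 (by rw [← hinv, h, hP0])
  obtain ⟨t, ht, hPt⟩ := exists_pos_primitive_eq_mul hP0 hP (hs1 z hz) hsz him
  refine ⟨t⁻¹, inv_pos.2 ht, ?_⟩
  rw [ofReal_inv, eq_inv_mul_iff_mul_eq₀ (ofReal_ne_zero.2 ht.ne'), ← hPt, hinv]
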